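/- arXiv:2008.11135 — 3 statements merged into one kernel-verified Lean document; each statement's English description precedes it below -/
import Mathlib

section
/- Let A and B be positive definite Hermitian n×n complex matrices. Then ∫₀¹ A^{1−s} (log A − log B) B^{s} ds = A − B, where A^{1−s}, B^{s}, log A and log B are defined by the functional calculus of Hermitian matrices (applying x ↦ x^r and x ↦ log x to the eigenvalues). -/
open MeasureTheory Matrix
open scoped ComplexOrder

attribute [local instance] Matrix.normedAddCommGroup Matrix.normedSpace

/-- Functional calculus for Hermitian matrices: apply `f : ℝ → ℝ` to the eigenvalues in a
spectral decomposition `A = U diag(λᵢ) U*` (junk value `0` if `A` is not Hermitian). -/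
noncomputable def hermCFC {n : ℕ} (f : ℝ → ℝ) (A : Matrix (Fin n) (Fin n) ℂ) :
    Matrix (Fin n) (Fin n) ℂ :=
  if hA : A.IsHermitian then
    (hA.eigenvectorUnitary : Matrix (Fin n) (Fin n) ℂ) *
      Matrix.diagonal (fun i => (f (hA.eigenvalues i) : ℂ)) *
      star (hA.eigenvectorUnitary : Matrix (Fin n) (Fin n) ℂ)
  else 0

theorem hermCFC_mul {n : ℕ} (f g : ℝ → ℝ) (A : Matrix (Fin n) (Fin n) ℂ) :
    hermCFC f A * hermCFC g A = hermCFC (fun x => f x * g x) A := by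
  unfold hermCFC
  split_ifs with hA
  · have hU : star (hA.eigenvectorUnitary : Matrix (Fin n) (Fin n) ℂ) *
        (hA.eigenvectorUnitary : Matrix (Fin n) (Fin n) ℂ) = 1 :=
      Unitary.coe_star_mul_self hA.eigenvectorUnitary
    simp only [Matrix.mul_assoc]
    rw [← Matrix.mul_assoc (star _) _ (_ * _), hU, Matrix.one_mul,
      ← Matrix.mul_assoc (diagonal _) (diagonal _), diagonal_mul_diagonal]
    simp
  · simp

theorem hermCFC_id {n : ℕ} {A : Matrix (Fin n) (Fin n) ℂ} (hA : A.IsHermitian) :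
    hermCFC (fun x => x) A = A := by
  conv_rhs => rw [hA.spectral_theorem]
  simp [hermCFC, hA, Unitary.conjStarAlgAut_apply, Function.comp_def]

theorem hermCFC_one {n : ℕ} {A : Matrix (Fin n) (Fin n) ℂ} (hA : A.IsHermitian) :
    hermCFC (fun _ => 1) A = 1 := by
  simp [hermCFC, hA]

theorem hasDerivAt_matrix_iff {m n : ℕ} {F : ℝ → Matrix (Fin m) (Fin n) ℂ}
    {F' : Matrix (Fin m) (Fin n) ℂ} {s : ℝ} :
    HasDerivAt F F' s ↔ ∀ i j, HasDerivAt (fun t => F t i j) (F' i j) s :=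
  hasDerivAt_pi.trans (forall_congr' fun _ => hasDerivAt_pi)

theorem HasDerivAt.matrix_mul_real {l m n : ℕ} {F : ℝ → Matrix (Fin l) (Fin m) ℂ}
    {G : ℝ → Matrix (Fin m) (Fin n) ℂ} {F' : Matrix (Fin l) (Fin m) ℂ}
    {G' : Matrix (Fin m) (Fin n) ℂ} {s : ℝ} (hF : HasDerivAt F F' s) (hG : HasDerivAt G G' s) :
    HasDerivAt (fun t => F t * G t) (F' * G s + F s * G') s := by
  rw [hasDerivAt_matrix_iff] at *
  intro i j
  simp only [Matrix.mul_apply, Matrix.add_apply, ← Finset.sum_add_distrib]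
  exact HasDerivAt.fun_sum fun k _ => (hF i k).mul (hG k j)

/-- Differentiation under the functional calculus of a positive definite matrix. -/
theorem hasDerivAt_hermCFC {n : ℕ} {f : ℝ → ℝ → ℝ} {f' : ℝ → ℝ} {s : ℝ}
    {A : Matrix (Fin n) (Fin n) ℂ} (hA : A.PosDef)
    (h : ∀ x, 0 < x → HasDerivAt (fun t => f t x) (f' x) s) :
    HasDerivAt (fun t => hermCFC (f t) A) (hermCFC f' A) s := by
  rw [hasDerivAt_matrix_iff]
  intro i j
  simp only [hermCFC, hA.isHermitian, dite_true]
  simp only [Matrix.mul_apply (M := _ * _), mul_diagonal]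
  exact HasDerivAt.fun_sum fun k _ =>
    ((h _ (hA.eigenvalues_pos k)).ofReal_comp.const_mul _).mul_const _

theorem hasDerivAt_hermCFC_rpow {n : ℕ} {A : Matrix (Fin n) (Fin n) ℂ} (hA : A.PosDef) (s : ℝ) :
    HasDerivAt (fun t : ℝ => hermCFC (fun x => x ^ t) A)
      (hermCFC Real.log A * hermCFC (fun x => x ^ s) A) s := by
  rw [hermCFC_mul]
  refine hasDerivAt_hermCFC hA fun x hx => ?_
  simpa [mul_comm] using (hasDerivAt_id s).const_rpow hx

theorem hasDerivAt_hermCFC_rpow_one_sub {n : ℕ} {A : Matrix (Fin n) (Fin n) ℂ} (hA : A.PosDef)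
    (s : ℝ) :
    HasDerivAt (fun t : ℝ => hermCFC (fun x => x ^ (1 - t)) A)
      (-(hermCFC (fun x => x ^ (1 - s)) A * hermCFC Real.log A)) s := by
  rw [hermCFC_mul, show (fun x : ℝ => x ^ (1 - s) * Real.log x) =
    fun x => Real.log x * x ^ (1 - s) from funext fun x => mul_comm _ _, ← hermCFC_mul,
    ← neg_one_smul ℝ]
  exact (hasDerivAt_hermCFC_rpow hA (1 - s)).scomp s ((hasDerivAt_id s).const_sub 1)

/-- For positive definite Hermitian matrices `A`, `B`,
`∫₀¹ A^{1−s} (log A − log B) B^{s} ds = A − B`, where matrix powers and logarithms are given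
by the functional calculus of Hermitian matrices. -/
theorem integral_rpow_mul_log_sub_log_mul_rpow
    {n : ℕ} (A B : Matrix (Fin n) (Fin n) ℂ) (hA : A.PosDef) (hB : B.PosDef) :
    ∫ s in (0:ℝ)..1,
        hermCFC (fun x => x ^ (1 - s)) A * (hermCFC Real.log A - hermCFC Real.log B) *
          hermCFC (fun x => x ^ s) B = A - B := by
  have hderiv (s : ℝ) : HasDerivAt
      (fun t : ℝ => -(hermCFC (fun x => x ^ (1 - t)) A * hermCFC (fun x => x ^ t) B))
      (hermCFC (fun x => x ^ (1 - s)) A * (hermCFC Real.log A - hermCFC Real.log B) *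
          hermCFC (fun x => x ^ s) B) s := by
    have hD : hermCFC (fun x => x ^ (1 - s)) A * (hermCFC Real.log A - hermCFC Real.log B) *
          hermCFC (fun x => x ^ s) B =
        -(-(hermCFC (fun x => x ^ (1 - s)) A * hermCFC Real.log A) * hermCFC (fun x => x ^ s) B +
          hermCFC (fun x => x ^ (1 - s)) A * (hermCFC Real.log B * hermCFC (fun x => x ^ s) B)) := by
      noncomm_ring
    rw [hD]
    exact ((hasDerivAt_hermCFC_rpow_one_sub hA s).matrix_mul_real
      (hasDerivAt_hermCFC_rpow hB s)).fun_neg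
  have hcA : Continuous fun s : ℝ => hermCFC (fun x => x ^ (1 - s)) A :=
    continuous_iff_continuousAt.2 fun s => (hasDerivAt_hermCFC_rpow_one_sub hA s).continuousAt
  have hcB : Continuous fun s : ℝ => hermCFC (fun x => x ^ s) B :=
    continuous_iff_continuousAt.2 fun s => (hasDerivAt_hermCFC_rpow hB s).continuousAt
  rw [intervalIntegral.integral_eq_sub_of_hasDerivAt (fun s _ => hderiv s)
    (((hcA.matrix_mul continuous_const).matrix_mul hcB).intervalIntegrable 0 1)]
  simp only [sub_zero, sub_self, Real.rpow_one, Real.rpow_zero, hermCFC_id hA.isHermitian,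
    hermCFC_id hB.isHermitian, hermCFC_one hA.isHermitian, hermCFC_one hB.isHermitian,
    Matrix.mul_one, Matrix.one_mul]
  abel
end

section
/- Let θ ∈ ℝ with 2e^θ + e^{2θ} − 2 ≠ 0, let M(θ) = (1/2)·[[1, 0, 1−e^{−θ}], [0, 1, −e^{−θ}], [1−e^{−θ}, −e^{−θ}, 2]], and let v = (−1, 1, 0)ᵀ ∈ ℝ³. Then the Wasserstein information matrix of the depolarizing channel family, G_W(θ) := (e^{−2θ}/4)·⟨v, M(θ)⁻¹ v⟩, equals e^{−2θ}·(3e^{2θ} + 4e^θ − 4) / (2·(e^{2θ} + 2e^θ − 2)). -/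
open Matrix

/-- The matrix representation of the weighted Laplacian `−Δ_{Φ_θ(ρ)}` on the orthogonal
complement of the identity, for the depolarizing channel in the two-fermion
Fokker-Planck setting. -/
noncomputable def deplLap (θ : ℝ) : Matrix (Fin 3) (Fin 3) ℝ :=
  (1 / 2 : ℝ) •
    !![1, 0, 1 - Real.exp (-θ);
       0, 1, -Real.exp (-θ);
       1 - Real.exp (-θ), -Real.exp (-θ), 2]

/-- The determinant of `deplLap θ`, cleared of negative exponentials. -/
theorem det_deplLap (θ : ℝ) :
    (deplLap θ).det =
      (2 * Real.exp θ + Real.exp (2 * θ) - 2) / (8 * Real.exp (2 * θ)) := by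
  have hE : Real.exp θ ≠ 0 := Real.exp_ne_zero θ
  have h2 : Real.exp (2 * θ) = Real.exp θ ^ 2 := by rw [two_mul, Real.exp_add, sq]
  simp only [deplLap, Real.exp_neg, h2, det_smul, det_fin_three, Fintype.card_fin]
  simp
  field_simp
  ring

/-- The solution of `deplLap θ *ᵥ w = (-1, 1, 0)`. -/
theorem inv_deplLap_mulVec (θ : ℝ)
    (h : 2 * Real.exp θ + Real.exp (2 * θ) - 2 ≠ 0) :
    (deplLap θ)⁻¹ *ᵥ ![-1, 1, 0] =
      (2 / (2 * Real.exp θ + Real.exp (2 * θ) - 2)) •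
        ![2 - Real.exp θ - 2 * Real.exp (2 * θ),
          3 * Real.exp θ + Real.exp (2 * θ) - 2, Real.exp (2 * θ)] := by
  have hdet : IsUnit (deplLap θ).det := by
    rw [det_deplLap, isUnit_iff_ne_zero]
    exact div_ne_zero h (by positivity)
  let _ := invertibleOfIsUnitDet _ hdet
  apply inv_mulVec_eq_vec
  have hE : Real.exp θ ≠ 0 := Real.exp_ne_zero θ
  have h2 : Real.exp (2 * θ) = Real.exp θ ^ 2 := by rw [two_mul, Real.exp_add, sq]
  rw [h2] at h ⊢
  have h' : Real.exp θ * (2 + Real.exp θ) - 2 ≠ 0 := by convert h using 2; ring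
  ext i
  fin_cases i <;>
    simp [deplLap, Real.exp_neg, mulVec, dotProduct, Fin.sum_univ_three] <;>
    field_simp <;> ring

/-- With `v = (−1,1,0)ᵀ`, the Wasserstein information matrix of the depolarizing-channel
family, `G_W(θ) = (e^{−2θ}/4)·⟨v, M(θ)⁻¹ v⟩`, equals
`e^{−2θ}(3e^{2θ} + 4e^θ − 4)/(2(e^{2θ} + 2e^θ − 2))`. -/
theorem wassersteinInfo_depolarizing (θ : ℝ)
    (h : 2 * Real.exp θ + Real.exp (2 * θ) - 2 ≠ 0) :
    (Real.exp (-2 * θ) / 4) * (![-1, 1, 0] ⬝ᵥ (deplLap θ)⁻¹ *ᵥ ![-1, 1, 0]) =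
      Real.exp (-2 * θ) * (3 * Real.exp (2 * θ) + 4 * Real.exp θ - 4) /
        (2 * (Real.exp (2 * θ) + 2 * Real.exp θ - 2)) := by
  rw [inv_deplLap_mulVec θ h]
  have h' : Real.exp (2 * θ) + 2 * Real.exp θ - 2 ≠ 0 := by rwa [add_comm (Real.exp (2 * θ))]
  simp [dotProduct, Fin.sum_univ_three]
  field_simp
  ring
end

section
/- Fix N > 0 and let p : ℕ → ℝ satisfy pₙ ≥ 0 for all n, Σ_{n=0}^∞ pₙ = 1, Σ_{n=0}^∞ n·pₙ ≤ N, and suppose the entropy series Σ_{n=0}^∞ pₙ·log(1/pₙ) converges (with the convention 0·log(1/0) = 0). Then −Σ_{n=0}^∞ pₙ log pₙ ≤ (N+1)·log(N+1) − N·log N, with equality for the geometric distribution pₙ = (1/(N+1))·(N/(N+1))ⁿ. In particular, among probability distributions on ℕ with mean at most N, the geometric distribution of the thermal state ρ_N maximizes the Shannon entropy. -/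
/-- Gibbs' inequality for a single term. -/
lemma mul_log_one_div_le {a b : ℝ} (ha : 0 ≤ a) (hb : 0 < b) :
    a * Real.log (1 / a) ≤ a * -Real.log b + (b - a) := by
  rcases ha.eq_or_lt with rfl | ha
  · simpa using hb.le
  · have h := mul_le_mul_of_nonneg_left (Real.log_le_sub_one_of_pos (div_pos hb ha)) ha.le
    rw [Real.log_div hb.ne' ha.ne', mul_sub, mul_sub, mul_div_cancel₀ b ha.ne'] at h
    rw [one_div, Real.log_inv]
    linarith

lemma hasSum_thermal {N : ℝ} (hN : 0 < N) :
    HasSum (fun n : ℕ => (1 / (N + 1)) * (N / (N + 1)) ^ n) 1 := by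
  have hr : N / (N + 1) < 1 := (div_lt_one (by linarith)).2 (by linarith)
  have h := (hasSum_geometric_of_lt_one (by positivity) hr).mul_left (1 / (N + 1))
  have hsub : 1 - N / (N + 1) = 1 / (N + 1) := by field_simp; ring
  have hval : 1 / (N + 1) * (1 - N / (N + 1))⁻¹ = 1 := by
    rw [hsub]
    field_simp
  rwa [hval] at h

lemma hasSum_coe_mul_thermal {N : ℝ} (hN : 0 < N) :
    HasSum (fun n : ℕ => (n : ℝ) * ((1 / (N + 1)) * (N / (N + 1)) ^ n)) N := by
  have hr : N / (N + 1) < 1 := (div_lt_one (by linarith)).2 (by linarith)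
  have hr' : ‖N / (N + 1)‖ < 1 := by rwa [Real.norm_of_nonneg (by positivity)]
  have h := (hasSum_coe_mul_geometric_of_norm_lt_one hr').mul_left (1 / (N + 1))
  have hsub : 1 - N / (N + 1) = 1 / (N + 1) := by field_simp; ring
  have hval : 1 / (N + 1) * (N / (N + 1) / (1 - N / (N + 1)) ^ 2) = N := by
    rw [hsub]
    field_simp
  rw [hval] at h
  simpa only [mul_left_comm] using h

lemma log_thermal {N : ℝ} (hN : 0 < N) (n : ℕ) :
    Real.log ((1 / (N + 1)) * (N / (N + 1)) ^ n) =
      -(Real.log (N + 1) + n * (Real.log (N + 1) - Real.log N)) := by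
  have hN1 : 0 < N + 1 := by linarith
  rw [Real.log_mul (by positivity) (by positivity), Real.log_pow,
    Real.log_div hN.ne' hN1.ne', one_div, Real.log_inv]
  ring

/-- Among probability distributions `p` on `ℕ` with mean at most `N`, the Shannon entropy
`−Σ pₙ log pₙ` is at most `(N+1)log(N+1) − N log N`, with equality for the geometric
distribution `pₙ = (1/(N+1))(N/(N+1))ⁿ` of the thermal state `ρ_N`. (Here `0·log(1/0) = 0`
holds automatically since `Real.log 0 = 0`.) -/
theorem entropy_le_thermal_entropy (N : ℝ) (hN : 0 < N) (p : ℕ → ℝ)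
    (hp : ∀ n, 0 ≤ p n)
    (hp1 : ∑' n : ℕ, p n = 1)
    (hmean_summable : Summable fun n : ℕ => (n : ℝ) * p n)
    (hmean : ∑' n : ℕ, (n : ℝ) * p n ≤ N)
    (hent : Summable fun n : ℕ => p n * Real.log (1 / p n)) :
    (-∑' n : ℕ, p n * Real.log (p n) ≤ (N + 1) * Real.log (N + 1) - N * Real.log N) ∧
      (-∑' n : ℕ, ((1 / (N + 1)) * (N / (N + 1)) ^ n) *
          Real.log ((1 / (N + 1)) * (N / (N + 1)) ^ n) =
        (N + 1) * Real.log (N + 1) - N * Real.log N) := by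
  have hq := hasSum_thermal hN
  constructor
  · have hps : HasSum p 1 := by
      have hs : Summable p := by
        by_contra h
        simp [tsum_eq_zero_of_not_summable h] at hp1
      exact hp1 ▸ hs.hasSum
    have hD : 0 ≤ Real.log (N + 1) - Real.log N :=
      sub_nonneg.2 (Real.log_le_log hN (by linarith))
    have hbound := ((hps.mul_right (Real.log (N + 1))).add
      (hmean_summable.hasSum.mul_right (Real.log (N + 1) - Real.log N))).add (hq.sub hps)
    have hle := hasSum_le (fun n => ?_) hent.hasSum hbound
    · have hneg : -∑' n : ℕ, p n * Real.log (p n) = ∑' n : ℕ, p n * Real.log (1 / p n) := by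
        rw [← tsum_neg]
        exact tsum_congr fun n => by rw [one_div, Real.log_inv, mul_neg]
      rw [hneg]
      linarith [mul_le_mul_of_nonneg_right hmean hD]
    · have h := mul_log_one_div_le (hp n)
        (show 0 < (1 / (N + 1)) * (N / (N + 1)) ^ n by positivity)
      rw [log_thermal hN] at h
      linarith
  · have hsum := ((hq.mul_right (Real.log (N + 1))).add
      ((hasSum_coe_mul_thermal hN).mul_right (Real.log (N + 1) - Real.log N)))
    rw [← tsum_neg]
    convert hsum.tsum_eq using 1
    · refine tsum_congr fun n => ?_
      rw [log_thermal hN]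
      ring
    · ring
end
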